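/- Let M ≥ 2 and let (I_1, …, I_M) be a user-irrepressible family of subsets of Z_L, each of Hamming weight M+1. Then for all i ≠ j in {1,…,M}, all k ∈ B_i with τ_k ∈ T_{i,k}, and all l ∈ B_j with τ_l ∈ T_{j,l}, if the unordered pairs {i,k} and {j,l} are distinct, then d*(I_{i,k,τ_k}) ∩ d*(I_{j,l,τ_l}) = ∅ (equivalently, |I_{i,k,τ_k} ∩ (I_{j,l,τ_l} + τ)| ≤ 1 for every τ ∈ Z_L). -/

import Mathlib

/-- The cyclic shift of a subset of `ZMod L` by `τ`. -/
def shiftF {L : ℕ} (S : Finset (ZMod L)) (τ : ZMod L) : Finset (ZMod L) :=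
  S.image (· + τ)

/-- Hamming cross-correlation of `I₁` and `I₂` at relative shift `τ`. -/
def Hcc {L : ℕ} (I₁ I₂ : Finset (ZMod L)) (τ : ZMod L) : ℕ :=
  (I₁ ∩ shiftF I₂ τ).card

/-- Maximum Hamming cross-correlation of `I₁` and `I₂` over all shifts. -/
def Hmax {L : ℕ} [NeZero L] (I₁ I₂ : Finset (ZMod L)) : ℕ :=
  Finset.univ.sup (Hcc I₁ I₂)

/-- A family `I : Fin M → Finset (ZMod L)` is user-irrepressible (UI). -/
def UI {L M : ℕ} (I : Fin M → Finset (ZMod L)) : Prop :=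
  ∀ i : Fin M, ∀ τ : Fin M → ZMod L,
    ¬ I i ⊆ (Finset.univ.erase i).biUnion fun j => shiftF (I j) (τ j)

/-- `Bset I i` is the set of indices `k ≠ i` maximizing `Hmax (I i) (I k)`. -/
def Bset {L M : ℕ} [NeZero L] (I : Fin M → Finset (ZMod L)) (i : Fin M) :
    Finset (Fin M) :=
  (Finset.univ.erase i).filter fun k =>
    ∀ j ∈ Finset.univ.erase i, Hmax (I i) (I j) ≤ Hmax (I i) (I k)

/-- `Tset I₁ I₂` is the set of relative shifts achieving the maximum cross-correlation. -/
def Tset {L : ℕ} [NeZero L] (I₁ I₂ : Finset (ZMod L)) : Finset (ZMod L) :=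
  Finset.univ.filter fun τ => Hcc I₁ I₂ τ = Hmax I₁ I₂

/-- The set of nonzero differences of elements of `S`. -/
def dstar {L : ℕ} (S : Finset (ZMod L)) : Finset (ZMod L) :=
  ((S ×ˢ S).filter fun p => p.1 ≠ p.2).image fun p => p.1 - p.2

theorem mem_shiftF {L : ℕ} {S : Finset (ZMod L)} {τ x : ZMod L} :
    x ∈ shiftF S τ ↔ ∃ y ∈ S, y + τ = x := by
  simp only [shiftF, Finset.mem_image]

theorem mem_dstar {L : ℕ} {S : Finset (ZMod L)} {d : ZMod L} :
    d ∈ dstar S ↔ ∃ a ∈ S, ∃ b ∈ S, a ≠ b ∧ a - b = d := by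
  simp only [dstar, Finset.mem_image, Finset.mem_filter, Finset.mem_product, Prod.exists]
  constructor
  · rintro ⟨a, b, ⟨⟨ha, hb⟩, hab⟩, h⟩
    exact ⟨a, ha, b, hb, hab, h⟩
  · rintro ⟨a, ha, b, hb, hab, h⟩
    exact ⟨a, b, ⟨⟨ha, hb⟩, hab⟩, h⟩

theorem dstar_mono {L : ℕ} {S T : Finset (ZMod L)} (h : S ⊆ T) : dstar S ⊆ dstar T := by
  intro d hd
  obtain ⟨a, ha, b, hb, hab, rfl⟩ := mem_dstar.1 hd
  exact mem_dstar.2 ⟨a, h ha, b, h hb, hab, rfl⟩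

/-- Nonempty sets indexed by `J` can be shifted so as to cover any set with at most `J.card`
elements. -/
theorem exists_shifts_cover {L : ℕ} {ι : Type*} [DecidableEq ι] {I : ι → Finset (ZMod L)}
    (hI : ∀ i, (I i).Nonempty) (S : Finset (ZMod L)) :
    ∀ J : Finset ι, S.card ≤ J.card →
      ∃ τ : ι → ZMod L, ∀ x ∈ S, ∃ j ∈ J, x ∈ shiftF (I j) (τ j) := by
  induction S using Finset.induction_on with
  | empty => exact fun J _ => ⟨0, by simp⟩
  | insert a S ha ih =>
    intro J hJ
    rw [Finset.card_insert_of_notMem ha] at hJ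
    obtain ⟨j, hj⟩ : J.Nonempty := Finset.card_pos.1 (by omega)
    obtain ⟨τ, hτ⟩ := ih (J.erase j) (by rw [Finset.card_erase_of_mem hj]; omega)
    obtain ⟨y, hy⟩ := hI j
    refine ⟨Function.update τ j (a - y), fun x hx => ?_⟩
    rcases Finset.mem_insert.1 hx with rfl | hx
    · exact ⟨j, hj, mem_shiftF.2 ⟨y, hy, by simp⟩⟩
    · obtain ⟨m, hm, hxm⟩ := hτ x hx
      refine ⟨m, Finset.mem_of_mem_erase hm, ?_⟩
      rwa [Function.update_of_ne (Finset.ne_of_mem_erase hm)]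

/-- In a user-irrepressible family of sets of weight `M + 1`, two shifted sets together cover at
most three elements of a third one. -/
theorem UI.card_inter_union_le {L M : ℕ} {I : Fin M → Finset (ZMod L)}
    (hw : ∀ i, (I i).card = M + 1) (hUI : UI I) {i j k : Fin M} (hij : i ≠ j) (hik : i ≠ k)
    (hjk : j ≠ k) (σ ρ : ZMod L) :
    (I i ∩ (shiftF (I j) σ ∪ shiftF (I k) ρ)).card ≤ 3 := by
  by_contra! hcard
  have hne : ∀ m, (I m).Nonempty := fun m => Finset.card_pos.1 (by rw [hw]; omega)
  have hJ : ((Finset.univ : Finset (Fin M)) \ {i, j, k}).card + 3 = M := by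
    rw [← Finset.card_eq_three.2 ⟨i, j, k, hij, hik, hjk, rfl⟩,
      Finset.card_sdiff_add_card_eq_card (Finset.subset_univ _), Finset.card_univ,
      Fintype.card_fin]
  have hS := Finset.card_sdiff_add_card_inter (I i) (shiftF (I j) σ ∪ shiftF (I k) ρ)
  rw [hw] at hS
  obtain ⟨τ, hτ⟩ := exists_shifts_cover hne (I i \ (shiftF (I j) σ ∪ shiftF (I k) ρ))
    ((Finset.univ : Finset (Fin M)) \ {i, j, k}) (by omega)
  refine hUI i (Function.update (Function.update τ j σ) k ρ) fun x hx => ?_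
  simp only [Finset.mem_biUnion, Finset.mem_erase, Finset.mem_univ, and_true]
  by_cases hxj : x ∈ shiftF (I j) σ
  · exact ⟨j, hij.symm, by simpa [Function.update_of_ne hjk] using hxj⟩
  by_cases hxk : x ∈ shiftF (I k) ρ
  · exact ⟨k, hik.symm, by simpa using hxk⟩
  obtain ⟨m, hm, hxm⟩ := hτ x (by simp [hx, hxj, hxk])
  simp only [Finset.mem_sdiff, Finset.mem_univ, Finset.mem_insert, Finset.mem_singleton,
    true_and, not_or] at hm
  exact ⟨m, hm.1, by rwa [Function.update_of_ne hm.2.2, Function.update_of_ne hm.2.1]⟩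

theorem UI.disjoint_dstar_sdiff {L M : ℕ} [NeZero L] {I : Fin M → Finset (ZMod L)}
    (hw : ∀ i, (I i).card = M + 1) (hUI : UI I) {i j k : Fin M} (hij : i ≠ j) (hjk : j ≠ k)
    (hk : k ∈ Bset I i) {τ : ZMod L} (hτ : τ ∈ Tset (I i) (I k)) :
    Disjoint (dstar (I i \ shiftF (I k) τ)) (dstar (I j)) := by
  refine Finset.disjoint_left.2 fun d hd hd' => ?_
  obtain ⟨a, ha, b, hb, hab, rfl⟩ := mem_dstar.1 hd
  obtain ⟨p, hp, q, hq, -, hpq⟩ := mem_dstar.1 hd'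
  rw [Finset.mem_sdiff] at ha hb
  simp only [Bset, Finset.mem_filter, Finset.mem_erase, Finset.mem_univ, and_true] at hk
  simp only [Tset, Finset.mem_filter, Finset.mem_univ, true_and] at hτ
  have haj : a ∈ shiftF (I j) (a - p) := mem_shiftF.2 ⟨p, hp, by ring⟩
  have hbj : b ∈ shiftF (I j) (a - p) := mem_shiftF.2 ⟨q, hq, by linear_combination -hpq⟩
  have hpair : ({a, b} : Finset (ZMod L)).card = 2 := Finset.card_pair hab
  have h2 : 2 ≤ Hcc (I i) (I j) (a - p) := by
    rw [← hpair]
    exact Finset.card_le_card (by simp [Finset.insert_subset_iff, ha.1, hb.1, haj, hbj])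
  have hmax : Hcc (I i) (I j) (a - p) ≤ Hmax (I i) (I j) := Finset.le_sup (Finset.mem_univ _)
  have hk2 : 2 ≤ (I i ∩ shiftF (I k) τ).card :=
    (h2.trans hmax).trans ((hk.2 j hij.symm).trans hτ.ge)
  have hdisj : Disjoint ({a, b} : Finset (ZMod L)) (I i ∩ shiftF (I k) τ) := by
    simp [ha.2, hb.2]
  have hsub : ({a, b} : Finset (ZMod L)) ∪ (I i ∩ shiftF (I k) τ) ⊆
      I i ∩ (shiftF (I j) (a - p) ∪ shiftF (I k) τ) := by
    intro x hx
    simp only [Finset.mem_union, Finset.mem_insert, Finset.mem_singleton, Finset.mem_inter] at hx ⊢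
    rcases hx with (rfl | rfl) | hx
    · exact ⟨ha.1, Or.inl haj⟩
    · exact ⟨hb.1, Or.inl hbj⟩
    · exact ⟨hx.1, Or.inr hx.2⟩
  have hle := Finset.card_le_card hsub
  rw [Finset.card_union_of_disjoint hdisj, hpair] at hle
  have := hUI.card_inter_union_le hw hij hk.1.symm hjk (a - p) τ
  omega

theorem card_inter_shiftF_le_one {L : ℕ} {S T : Finset (ZMod L)}
    (h : Disjoint (dstar S) (dstar T)) (τ : ZMod L) : (S ∩ shiftF T τ).card ≤ 1 := by
  refine Finset.card_le_one.2 fun a ha b hb => ?_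
  by_contra hab
  rw [Finset.mem_inter, mem_shiftF] at ha hb
  obtain ⟨ha, p, hp, rfl⟩ := ha
  obtain ⟨hb, q, hq, rfl⟩ := hb
  refine Finset.disjoint_left.1 h (mem_dstar.2 ⟨_, ha, _, hb, hab, rfl⟩)
    (mem_dstar.2 ⟨p, hp, q, hq, fun h => hab (by rw [h]), by ring⟩)

theorem stmt5 {L M : ℕ} [NeZero L] (hM : 2 ≤ M) (I : Fin M → Finset (ZMod L))
    (hw : ∀ i, (I i).card = M + 1) (hUI : UI I) :
    ∀ i j k l : Fin M, i ≠ j → k ∈ Bset I i → l ∈ Bset I j →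
      ∀ τk ∈ Tset (I i) (I k), ∀ τl ∈ Tset (I j) (I l),
        ({i, k} : Finset (Fin M)) ≠ ({j, l} : Finset (Fin M)) →
          dstar (I i \ shiftF (I k) τk) ∩ dstar (I j \ shiftF (I l) τl) = ∅ ∧
          ∀ τ : ZMod L,
            ((I i \ shiftF (I k) τk) ∩
              shiftF (I j \ shiftF (I l) τl) τ).card ≤ 1 := by
  intro i j k l hij hk hl τk hτk τl hτl hne
  have h : Disjoint (dstar (I i \ shiftF (I k) τk)) (dstar (I j \ shiftF (I l) τl)) := by
    by_cases hjk : j = k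
    · have hil : i ≠ l := by
        rintro rfl
        exact hne (by rw [hjk, Finset.pair_comm])
      exact ((hUI.disjoint_dstar_sdiff hw hij.symm hil hl hτl).mono_right
        (dstar_mono Finset.sdiff_subset)).symm
    · exact (hUI.disjoint_dstar_sdiff hw hij hjk hk hτk).mono_right
        (dstar_mono Finset.sdiff_subset)
  exact ⟨Finset.disjoint_iff_inter_eq_empty.1 h, card_inter_shiftF_le_one h⟩
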